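/- Let A ∈ ℂ^{m×n} be a nonzero matrix, r_1,…,r_m ∈ ℂ^n the conjugate transposes of the m rows of A, r_j a row vector among r_1,…,r_m with the largest 2-norm, v ∈ ℂ^n a right singular vector corresponding to the largest singular value of A (i.e. v ≠ 0 and ‖Av‖_2 = ‖A‖_{2→2}‖v‖_2), y ∈ ℂ^n a nonzero vector achieving the 1→q norm of A (i.e. ‖Ay‖_q = ‖A‖_{1→q}‖y‖_1), and S = {v, r_1, …, r_m}. Then for all real numbers p, q with 1 ≤ p ≤ 2 ≤ q < ∞: max_{x ∈ S ∪ {y}, x ≠ 0} ‖Ax‖_q/‖x‖_p ≥ [ ‖y‖_1/‖y‖_p ]^{(2−p)/p} · ( [ ‖Ar_j‖_q/(2‖Ar_j‖_∞) ]^{(q−2)/(2(q−1))} · [ ‖Av‖_q/‖Av‖_2 ]^{1/(q−1)} · min_{x ∈ S, x ≠ 0} ‖x‖_2/‖x‖_p )^{2(p−1)/p} · ‖A‖_{p→q}. -/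

import Mathlib

open scoped BigOperators

/-- The `ℓ_p` norm of a vector, for a real exponent `p`. -/
noncomputable def lpnorm {n : ℕ} {𝕜 : Type*} [RCLike 𝕜] (p : ℝ) (x : Fin n → 𝕜) : ℝ :=
  (∑ i, ‖x i‖ ^ p) ^ (1 / p)

/-- The `ℓ_∞` norm of a vector. -/
noncomputable def linorm {n : ℕ} {𝕜 : Type*} [RCLike 𝕜] (x : Fin n → 𝕜) : ℝ :=
  ⨆ i, ‖x i‖

/-- The `p → q` operator norm of a matrix: `max_{x ≠ 0} ‖Ax‖_q / ‖x‖_p`. -/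
noncomputable def opNorm {m n : ℕ} {𝕜 : Type*} [RCLike 𝕜] (p q : ℝ)
    (A : Matrix (Fin m) (Fin n) 𝕜) : ℝ :=
  ⨆ x : {x : Fin n → 𝕜 // x ≠ 0}, lpnorm q (A.mulVec x.1) / lpnorm p x.1

/-- The `p → ∞` operator norm of a matrix: `max_{x ≠ 0} ‖Ax‖_∞ / ‖x‖_p`. -/
noncomputable def opNormInf {m n : ℕ} {𝕜 : Type*} [RCLike 𝕜] (p : ℝ)
    (A : Matrix (Fin m) (Fin n) 𝕜) : ℝ :=
  ⨆ x : {x : Fin n → 𝕜 // x ≠ 0}, linorm (A.mulVec x.1) / lpnorm p x.1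

/-- `row A i` is the conjugate transpose of the `i`-th row of `A`,
so that `(A x) i = ⟨x, row A i⟩` for the standard Hermitian inner product. -/
def row {m n : ℕ} {𝕜 : Type*} [RCLike 𝕜] (A : Matrix (Fin m) (Fin n) 𝕜) (i : Fin m) :
    Fin n → 𝕜 := fun k => star (A i k)

/-- The standard Hermitian inner product `⟨x, y⟩ = ∑ k, x k * conj (y k)`. -/
noncomputable def hinner {n : ℕ} (x y : Fin n → ℂ) : ℂ := ∑ k, x k * star (y k)

section lpnorm

variable {n : ℕ} {p : ℝ}

theorem lpnorm_nonneg (p : ℝ) (x : Fin n → ℂ) : 0 ≤ lpnorm p x :=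
  Real.rpow_nonneg (Finset.sum_nonneg fun _ _ => Real.rpow_nonneg (norm_nonneg _) _) _

theorem lpnorm_rpow (hp : 0 < p) (x : Fin n → ℂ) : lpnorm p x ^ p = ∑ i, ‖x i‖ ^ p := by
  rw [lpnorm, one_div, Real.rpow_inv_rpow _ hp.ne']
  exact Finset.sum_nonneg fun _ _ => Real.rpow_nonneg (norm_nonneg _) _

theorem lpnorm_zero (hp : 0 < p) : lpnorm p (0 : Fin n → ℂ) = 0 := by
  simp [lpnorm, Real.zero_rpow hp.ne', hp.ne']

theorem norm_le_lpnorm (hp : 0 < p) (x : Fin n → ℂ) (i : Fin n) : ‖x i‖ ≤ lpnorm p x := by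
  rw [← Real.rpow_le_rpow_iff (norm_nonneg _) (lpnorm_nonneg p x) hp, lpnorm_rpow hp]
  exact Finset.single_le_sum (f := fun i => ‖x i‖ ^ p)
    (fun _ _ => Real.rpow_nonneg (norm_nonneg _) _) (Finset.mem_univ i)

theorem lpnorm_pos (hp : 0 < p) {x : Fin n → ℂ} (hx : x ≠ 0) : 0 < lpnorm p x := by
  obtain ⟨i, hi⟩ := Function.ne_iff.mp hx
  exact (norm_pos_iff.mpr hi).trans_le (norm_le_lpnorm hp x i)

theorem lpnorm_one (x : Fin n → ℂ) : lpnorm 1 x = ∑ i, ‖x i‖ := by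
  simp [lpnorm]

theorem lpnorm_two_sq (x : Fin n → ℂ) : lpnorm 2 x ^ 2 = ∑ i, ‖x i‖ ^ 2 := by
  simpa using lpnorm_rpow two_pos x

theorem lpnorm_eq_norm (hp : 0 < p) (x : Fin n → ℂ) :
    lpnorm p x = ‖WithLp.toLp (ENNReal.ofReal p) x‖ := by
  have h : (ENNReal.ofReal p).toReal = p := ENNReal.toReal_ofReal hp.le
  rw [PiLp.norm_eq_sum (by rwa [h]), h, lpnorm]

theorem lpnorm_smul (hp : 1 ≤ p) (c : ℂ) (x : Fin n → ℂ) :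
    lpnorm p (c • x) = ‖c‖ * lpnorm p x := by
  have hp0 : 0 < p := by linarith
  have : Fact (1 ≤ ENNReal.ofReal p) := ⟨by simpa using hp⟩
  rw [lpnorm_eq_norm hp0, lpnorm_eq_norm hp0, WithLp.toLp_smul, norm_smul]

theorem lpnorm_sum_le {ι : Type*} (hp : 1 ≤ p) (s : Finset ι) (f : ι → Fin n → ℂ) :
    lpnorm p (∑ i ∈ s, f i) ≤ ∑ i ∈ s, lpnorm p (f i) := by
  have hp0 : 0 < p := by linarith
  have : Fact (1 ≤ ENNReal.ofReal p) := ⟨by simpa using hp⟩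
  simp only [lpnorm_eq_norm hp0, WithLp.toLp_sum]
  exact norm_sum_le _ _

theorem norm_dotProduct_le {q : ℝ} (hpq : p.HolderConjugate q) (x y : Fin n → ℂ) :
    ‖x ⬝ᵥ y‖ ≤ lpnorm p x * lpnorm q y := by
  refine (norm_sum_le _ _).trans ?_
  simpa [lpnorm] using
    Real.inner_le_Lp_mul_Lq Finset.univ (fun i => ‖x i‖) (fun i => ‖y i‖) hpq

theorem lpnorm_star (p : ℝ) (x : Fin n → ℂ) : lpnorm p (star x) = lpnorm p x := by
  simp [lpnorm]

theorem star_dotProduct_self (x : Fin n → ℂ) : ‖star x ⬝ᵥ x‖ = lpnorm 2 x ^ 2 := by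
  have h : star x ⬝ᵥ x = ((∑ i, ‖x i‖ ^ 2 : ℝ) : ℂ) := by
    simp [dotProduct, Complex.conj_mul']
  rw [h, lpnorm_two_sq, Complex.norm_real, Real.norm_of_nonneg]
  positivity

end lpnorm

section opNorm

variable {m n : ℕ} {p q : ℝ}

theorem bddAbove_opNorm (hp : 1 ≤ p) (hq : 1 ≤ q) (A : Matrix (Fin m) (Fin n) ℂ) :
    BddAbove (Set.range fun x : {x : Fin n → ℂ // x ≠ 0} =>
      lpnorm q (A.mulVec x.1) / lpnorm p x.1) := by
  refine ⟨∑ k, lpnorm q (A.col k), ?_⟩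
  rintro _ ⟨⟨x, hx⟩, rfl⟩
  have hp0 : 0 < p := by linarith
  refine (div_le_iff₀ (lpnorm_pos hp0 hx)).mpr ?_
  have h : A.mulVec x = ∑ k, x k • A.col k := by
    ext i
    simp [Matrix.mulVec, dotProduct, mul_comm]
  rw [h, Finset.sum_mul]
  refine (lpnorm_sum_le hq _ _).trans (Finset.sum_le_sum fun k _ => ?_)
  rw [lpnorm_smul hq, mul_comm]
  exact mul_le_mul_of_nonneg_left (norm_le_lpnorm hp0 x k) (lpnorm_nonneg _ _)

theorem opNorm_nonneg (p q : ℝ) (A : Matrix (Fin m) (Fin n) ℂ) : 0 ≤ opNorm p q A :=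
  Real.iSup_nonneg fun _ => div_nonneg (lpnorm_nonneg _ _) (lpnorm_nonneg _ _)

theorem lpnorm_mulVec_le_opNorm (hp : 1 ≤ p) (hq : 1 ≤ q) (A : Matrix (Fin m) (Fin n) ℂ)
    (x : Fin n → ℂ) : lpnorm q (A.mulVec x) ≤ opNorm p q A * lpnorm p x := by
  by_cases hx : x = 0
  · rw [hx, Matrix.mulVec_zero, lpnorm_zero (by linarith), lpnorm_zero (by linarith), mul_zero]
  · exact (div_le_iff₀ (lpnorm_pos (by linarith) hx)).mp
      (le_ciSup (bddAbove_opNorm hp hq A) ⟨x, hx⟩)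

theorem opNorm_le (hp : 0 < p) (A : Matrix (Fin m) (Fin n) ℂ) {C : ℝ} (hC : 0 ≤ C)
    (h : ∀ x, lpnorm q (A.mulVec x) ≤ C * lpnorm p x) : opNorm p q A ≤ C :=
  Real.iSup_le (fun x => (div_le_iff₀ (lpnorm_pos hp x.2)).mpr (h x.1)) hC

/-- Riesz–Thorin interpolation in the domain exponent, between `1 → q` and `2 → q` bounds. -/
theorem lpnorm_mulVec_le_interp (hp1 : 1 ≤ p) (hp2 : p ≤ 2) (hq : 1 ≤ q)
    (A : Matrix (Fin m) (Fin n) ℂ) {K L : ℝ} (hK : 0 ≤ K) (hL : 0 ≤ L)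
    (h1 : ∀ x, lpnorm q (A.mulVec x) ≤ K * lpnorm 1 x)
    (h2 : ∀ x, lpnorm q (A.mulVec x) ≤ L * lpnorm 2 x) (x : Fin n → ℂ) :
    lpnorm q (A.mulVec x) ≤ K ^ ((2 - p) / p) * L ^ (2 * (p - 1) / p) * lpnorm p x := by
  have hp0 : 0 < p := by linarith
  have hq0 : 0 < q := by linarith
  have : Fact (1 ≤ ENNReal.ofReal q) := ⟨by simpa using hq⟩
  let X : ℂ → Fin n → ℂ := fun z k =>
    x k / (‖x k‖ : ℂ) * Complex.exp ((Real.log ‖x k‖ : ℂ) * (p * (1 - z / 2)))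
  have hX : ∀ z : ℂ, z.re ≤ 1 → ∀ k, ‖X z k‖ = ‖x k‖ ^ (p * (1 - z.re / 2)) := by
    intro z hz k
    have hpos : 0 < p * (1 - z.re / 2) := mul_pos hp0 (by linarith)
    by_cases hk : x k = 0
    · simp [X, hk, Real.zero_rpow hpos.ne']
    · have hk' : 0 < ‖x k‖ := norm_pos_iff.mpr hk
      have hre : ((Real.log ‖x k‖ : ℂ) * (p * (1 - z / 2))).re
          = Real.log ‖x k‖ * (p * (1 - z.re / 2)) := by
        simp
      simp only [X]
      rw [norm_mul, norm_div, Complex.norm_real, norm_norm, div_self hk'.ne', one_mul,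
        Complex.norm_exp, hre, Real.rpow_def_of_pos hk']
  let S : ℝ := ∑ k, ‖x k‖ ^ p
  have hS : 0 ≤ S := Finset.sum_nonneg fun _ _ => Real.rpow_nonneg (norm_nonneg _) _
  have hd : Differentiable ℂ fun z => WithLp.toLp (ENNReal.ofReal q) (A.mulVec (X z)) := by
    have : Differentiable ℂ fun z => A.mulVec (X z) := by
      refine differentiable_pi.mpr fun i => ?_
      simp only [X, Matrix.mulVec, dotProduct]
      fun_prop
    exact (PiLp.continuousLinearEquiv (ENNReal.ofReal q) ℂ
      fun _ : Fin m => ℂ).symm.differentiable.comp this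
  set θ : ℝ := 2 * (p - 1) / p with hθ
  have hθ0 : 0 ≤ θ := div_nonneg (by linarith) hp0.le
  have hθ1 : θ ≤ 1 := (div_le_one hp0).mpr (by linarith)
  have key := Complex.HadamardThreeLines.norm_le_interp_of_mem_verticalClosedStrip₀₁'
    (fun z => WithLp.toLp (ENNReal.ofReal q) (A.mulVec (X z)))
    (z := (θ : ℂ)) (a := K * S) (b := L * S ^ (1 / 2 : ℝ))
    (by simpa [Complex.HadamardThreeLines.verticalClosedStrip] using ⟨hθ0, hθ1⟩)
    hd.diffContOnCl ?_ ?_ ?_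
  · rw [← lpnorm_eq_norm hq0] at key
    have hXθ : X (θ : ℂ) = x := by
      ext k
      by_cases hk : x k = 0
      · simp [X, hk]
      · have hk' : 0 < ‖x k‖ := norm_pos_iff.mpr hk
        have he : (p : ℂ) * (1 - (θ : ℂ) / 2) = 1 := by
          have : p * (1 - θ / 2) = 1 := by rw [hθ]; field_simp; ring
          exact_mod_cast this
        simp only [X]
        rw [he, mul_one, ← Complex.ofReal_exp, Real.exp_log hk',
          div_mul_cancel₀ _ (by exact_mod_cast hk'.ne')]
    rw [hXθ, Complex.ofReal_re] at key
    refine key.trans_eq ?_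
    have e1 : 1 - θ = (2 - p) / p := by rw [hθ]; field_simp; ring
    have e2 : S ^ (1 - θ) * (S ^ (1 / 2 : ℝ)) ^ θ = lpnorm p x := by
      have e3 : 1 / p = (1 - θ) + 1 / 2 * θ := by rw [hθ]; field_simp; ring
      rw [← Real.rpow_mul hS, ← Real.rpow_add_of_nonneg hS (by linarith) (by linarith), ← e3]
      rfl
    rw [Real.mul_rpow hK hS, Real.mul_rpow hL (Real.rpow_nonneg hS _), ← e1, ← e2]
    ring
  · refine ⟨K * ∑ k, (1 + ‖x k‖) ^ p, ?_⟩
    rintro _ ⟨z, hz, rfl⟩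
    obtain ⟨hz0, hz1⟩ := hz
    simp only [Function.comp_apply]
    rw [← lpnorm_eq_norm hq0]
    refine (h1 _).trans (mul_le_mul_of_nonneg_left ?_ hK)
    rw [lpnorm_one]
    refine Finset.sum_le_sum fun k _ => ?_
    have hk := norm_nonneg (x k)
    rw [hX z hz1]
    refine (Real.rpow_le_rpow hk (by linarith : ‖x k‖ ≤ 1 + ‖x k‖)
      (mul_nonneg hp0.le (by linarith))).trans (Real.rpow_le_rpow_of_exponent_le (by linarith) ?_)
    nlinarith
  · intro z hz
    replace hz : z.re = 0 := hz
    rw [← lpnorm_eq_norm hq0]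
    refine (h1 _).trans_eq ?_
    rw [lpnorm_one]
    congr 1
    refine Finset.sum_congr rfl fun k _ => ?_
    rw [hX z (by linarith), hz]
    simp
  · intro z hz
    replace hz : z.re = 1 := hz
    rw [← lpnorm_eq_norm hq0]
    refine (h2 _).trans_eq ?_
    rw [lpnorm]
    congr 2
    refine Finset.sum_congr rfl fun k _ => ?_
    rw [hX z hz.le, hz, ← Real.rpow_mul (norm_nonneg _)]
    congr 1
    ring

theorem lpnorm_conjTranspose_mulVec_sq_le {p' : ℝ} (hpp : p.HolderConjugate p')
    (A : Matrix (Fin m) (Fin n) ℂ) (g : Fin m → ℂ) :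
    lpnorm 2 (A.conjTranspose.mulVec g) ^ 2
      ≤ lpnorm p g * lpnorm p' (A.mulVec (A.conjTranspose.mulVec g)) := by
  rw [← star_dotProduct_self, Matrix.star_mulVec, Matrix.conjTranspose_conjTranspose,
    ← Matrix.dotProduct_mulVec, ← lpnorm_star p g]
  exact norm_dotProduct_le hpp _ _

theorem lpnorm_two_conjTranspose_mulVec_le (A : Matrix (Fin m) (Fin n) ℂ) (g : Fin m → ℂ) :
    lpnorm 2 (A.conjTranspose.mulVec g) ≤ opNorm 2 2 A * lpnorm 2 g := by
  have h := lpnorm_conjTranspose_mulVec_sq_le Real.HolderConjugate.two_two A g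
  have h' := lpnorm_mulVec_le_opNorm one_le_two one_le_two A (A.conjTranspose.mulVec g)
  have h0 := lpnorm_nonneg 2 g
  rcases (lpnorm_nonneg 2 (A.conjTranspose.mulVec g)).eq_or_lt with h1 | h1
  · rw [← h1]
    exact mul_nonneg (opNorm_nonneg _ _ _) h0
  · refine le_of_mul_le_mul_right ?_ h1
    nlinarith [mul_le_mul_of_nonneg_left h' h0]

/-- A bound for `A Aᴴ` from the dual exponent of `q` to `q` bounds `A` from `2` to `q`. -/
theorem sq_opNorm_two_le {q' : ℝ} (hqq : q'.HolderConjugate q) (A : Matrix (Fin m) (Fin n) ℂ)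
    {N : ℝ} (hN : 0 ≤ N)
    (h : ∀ g, lpnorm q (A.mulVec (A.conjTranspose.mulVec g)) ≤ N * lpnorm q' g) :
    opNorm 2 q A ^ 2 ≤ N := by
  suffices opNorm 2 q A ≤ √N by
    calc opNorm 2 q A ^ 2 ≤ √N ^ 2 := by gcongr; exact opNorm_nonneg _ _ _
      _ = N := Real.sq_sqrt hN
  refine opNorm_le two_pos A (Real.sqrt_nonneg _) fun u => ?_
  have hq0 := hqq.symm.pos
  set w := A.mulVec u with hw
  by_cases hw0 : w = 0
  · rw [hw0, lpnorm_zero hq0]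
    exact mul_nonneg (Real.sqrt_nonneg _) (lpnorm_nonneg _ _)
  have hwp := lpnorm_pos hq0 hw0
  let g : Fin m → ℂ := fun i => ((‖w i‖ ^ (q - 2) : ℝ) : ℂ) * w i
  have hgn : ∀ i, ‖g i‖ = ‖w i‖ ^ (q - 1) := by
    intro i
    by_cases hi : w i = 0
    · simp [g, hi, Real.zero_rpow hqq.symm.sub_one_pos.ne']
    · have hi' : 0 < ‖w i‖ := norm_pos_iff.mpr hi
      simp only [g]
      rw [norm_mul, Complex.norm_real, Real.norm_of_nonneg (Real.rpow_nonneg hi'.le _)]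
      nth_rewrite 2 [← Real.rpow_one ‖w i‖]
      rw [← Real.rpow_add hi']
      congr 1
      ring
  have hgq : lpnorm q' g = lpnorm q w ^ (q - 1) := by
    have e : (q - 1) * q' = q := hqq.symm.sub_one_mul_conj
    rw [← Real.rpow_left_inj (lpnorm_nonneg _ _) (Real.rpow_nonneg hwp.le _) hqq.pos.ne',
      lpnorm_rpow hqq.pos, ← Real.rpow_mul hwp.le, e, lpnorm_rpow hq0]
    refine Finset.sum_congr rfl fun i _ => ?_
    rw [hgn, ← Real.rpow_mul (norm_nonneg _), e]
  have hpair : ‖star g ⬝ᵥ w‖ = lpnorm q w ^ q := by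
    have hs : star g ⬝ᵥ w = ((∑ i, ‖w i‖ ^ q : ℝ) : ℂ) := by
      rw [dotProduct, Complex.ofReal_sum]
      refine Finset.sum_congr rfl fun i _ => ?_
      by_cases hi : w i = 0
      · simp [hi, Real.zero_rpow hq0.ne']
      · have hi' : 0 < ‖w i‖ := norm_pos_iff.mpr hi
        have e : ‖w i‖ ^ q = ‖w i‖ ^ (q - 2) * ‖w i‖ ^ 2 := by
          rw [← Real.rpow_natCast, ← Real.rpow_add hi']
          congr 1
          push_cast
          ring
        simp only [Pi.star_apply, g, RCLike.star_def, map_mul, Complex.conj_ofReal, mul_assoc,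
          Complex.conj_mul']
        rw [e]
        push_cast
        ring
    rw [hs, lpnorm_rpow hq0, Complex.norm_real, Real.norm_of_nonneg]
    positivity
  have hpair_le : ‖star g ⬝ᵥ w‖ ≤ lpnorm 2 (A.conjTranspose.mulVec g) * lpnorm 2 u := by
    have e : star g ⬝ᵥ w = star (A.conjTranspose.mulVec g) ⬝ᵥ u := by
      rw [Matrix.star_mulVec, Matrix.conjTranspose_conjTranspose, ← Matrix.dotProduct_mulVec]
    rw [e, ← lpnorm_star 2 (A.conjTranspose.mulVec g)]
    exact norm_dotProduct_le Real.HolderConjugate.two_two _ _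
  have hAg : lpnorm 2 (A.conjTranspose.mulVec g) ≤ √N * lpnorm q' g := by
    refine le_of_sq_le_sq ?_ (mul_nonneg (Real.sqrt_nonneg _) (lpnorm_nonneg _ _))
    rw [mul_pow, Real.sq_sqrt hN]
    refine (lpnorm_conjTranspose_mulVec_sq_le hqq A g).trans ?_
    nlinarith [mul_le_mul_of_nonneg_left (h g) (lpnorm_nonneg q' g)]
  have hpos : 0 < lpnorm q w ^ (q - 1) := Real.rpow_pos_of_pos hwp _
  refine le_of_mul_le_mul_left ?_ hpos
  have e : lpnorm q w ^ (q - 1) * lpnorm q w = lpnorm q w ^ q := by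
    nth_rewrite 2 [← Real.rpow_one (lpnorm q w)]
    rw [← Real.rpow_add hwp]
    congr 1
    ring
  calc lpnorm q w ^ (q - 1) * lpnorm q w = ‖star g ⬝ᵥ w‖ := by rw [e, hpair]
    _ ≤ lpnorm 2 (A.conjTranspose.mulVec g) * lpnorm 2 u := hpair_le
    _ ≤ (√N * lpnorm q' g) * lpnorm 2 u := mul_le_mul_of_nonneg_right hAg (lpnorm_nonneg _ _)
    _ = lpnorm q w ^ (q - 1) * (√N * lpnorm 2 u) := by rw [hgq]; ring

theorem opNorm_two_le (hq : 2 ≤ q) (A : Matrix (Fin m) (Fin n) ℂ) {C : ℝ} (hC : 0 ≤ C)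
    (h : ∀ i, lpnorm q (A.mulVec (row A i)) ≤ C) :
    opNorm 2 q A ≤ C ^ ((q - 2) / (2 * (q - 1))) * opNorm 2 2 A ^ (1 / (q - 1)) := by
  have hq1 : 1 < q := by linarith
  have hq0 : 0 < q := by linarith
  have hqs : 0 < q - 1 := by linarith
  have hK := opNorm_nonneg 2 q A
  have hσ := opNorm_nonneg 2 2 A
  set K := opNorm 2 q A
  set σ := opNorm 2 2 A
  have hqq : (q / (q - 1)).HolderConjugate q := (Real.HolderConjugate.conjExponent hq1).symm
  have hsq : K ^ 2 ≤ C ^ ((q - 2) / q) * (K * σ) ^ (2 / q) := by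
    refine sq_opNorm_two_le hqq A (by positivity) fun g => ?_
    have hr := lpnorm_mulVec_le_interp (p := q / (q - 1)) (q := q)
      ((one_le_div hqs).mpr (by linarith)) ((div_le_iff₀ hqs).mpr (by linarith)) hq1.le
      (A * A.conjTranspose) (K := C) (L := K * σ) hC (mul_nonneg hK hσ) ?_ ?_ g
    · have e1 : (2 - q / (q - 1)) / (q / (q - 1)) = (q - 2) / q := by field_simp; ring
      have e2 : 2 * (q / (q - 1) - 1) / (q / (q - 1)) = 2 / q := by field_simp; ring
      rwa [e1, e2, ← Matrix.mulVec_mulVec] at hr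
    · intro x
      have e : (A * A.conjTranspose).mulVec x = ∑ i, x i • A.mulVec (row A i) := by
        ext k
        simp [Matrix.mulVec, dotProduct, Matrix.mul_apply, row, mul_comm]
      rw [e, lpnorm_one, Finset.mul_sum]
      refine (lpnorm_sum_le hq1.le _ _).trans (Finset.sum_le_sum fun i _ => ?_)
      rw [lpnorm_smul hq1.le, mul_comm]
      exact mul_le_mul_of_nonneg_right (h i) (norm_nonneg _)
    · intro x
      rw [← Matrix.mulVec_mulVec, mul_assoc]
      exact (lpnorm_mulVec_le_opNorm one_le_two hq1.le A _).trans
        (mul_le_mul_of_nonneg_left (lpnorm_two_conjTranspose_mulVec_le A x) hK)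
  rcases hK.eq_or_lt with hK0 | hK0
  · rw [← hK0]
    positivity
  have hsplit : K ^ (2 * (q - 1) / q) ≤ C ^ ((q - 2) / q) * σ ^ (2 / q) := by
    refine le_of_mul_le_mul_left ?_ (Real.rpow_pos_of_pos hK0 (2 / q))
    have e : K ^ (2 / q) * K ^ (2 * (q - 1) / q) = K ^ 2 := by
      rw [← Real.rpow_add hK0, ← Real.rpow_natCast]
      congr 1
      push_cast
      field_simp
      ring
    rw [e]
    refine hsq.trans_eq ?_
    rw [Real.mul_rpow hK hσ]
    ring
  have hr := Real.rpow_le_rpow (by positivity) hsplit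
    (by positivity : 0 ≤ q / (2 * (q - 1)))
  rw [Real.mul_rpow (by positivity) (by positivity), ← Real.rpow_mul hK, ← Real.rpow_mul hC,
    ← Real.rpow_mul hσ] at hr
  have e1 : 2 * (q - 1) / q * (q / (2 * (q - 1))) = 1 := by field_simp
  have e2 : (q - 2) / q * (q / (2 * (q - 1))) = (q - 2) / (2 * (q - 1)) := by field_simp
  have e3 : 2 / q * (q / (2 * (q - 1))) = 1 / (q - 1) := by field_simp
  rwa [e1, e2, e3, Real.rpow_one] at hr

end opNorm

/-- The case `p = 2`: the ratios at `v` and at the rows control the `2 → q` norm. -/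
theorem ratio_mul_opNorm_two_le {m n : ℕ} {q : ℝ} (hq : 2 ≤ q) (A : Matrix (Fin m) (Fin n) ℂ)
    (j : Fin m) (hj : ∀ i, lpnorm 2 (row A i) ≤ lpnorm 2 (row A j))
    (v : Fin n → ℂ) (hv : v ≠ 0)
    (hsv : lpnorm 2 (A.mulVec v) = opNorm 2 2 A * lpnorm 2 v) {D : ℝ} (hD : 0 ≤ D)
    (hDv : lpnorm q (A.mulVec v) ≤ D * lpnorm 2 v)
    (hDr : ∀ i, lpnorm q (A.mulVec (row A i)) ≤ D * lpnorm 2 (row A i)) :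
    (lpnorm q (A.mulVec (row A j)) / (2 * linorm (A.mulVec (row A j)))) ^
          ((q - 2) / (2 * (q - 1))) *
        (lpnorm q (A.mulVec v) / lpnorm 2 (A.mulVec v)) ^ (1 / (q - 1)) * opNorm 2 q A ≤ D := by
  have hqs : 0 < q - 1 := by linarith
  have hR := lpnorm_nonneg 2 (row A j)
  have hσ := opNorm_nonneg 2 2 A
  have hlin : lpnorm 2 (row A j) ^ 2 ≤ linorm (A.mulVec (row A j)) := by
    have e : star (row A j) ⬝ᵥ row A j = A.mulVec (row A j) j := by
      simp [row, Matrix.mulVec, dotProduct]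
    rw [← star_dotProduct_self, e]
    exact le_ciSup (f := fun i => ‖A.mulVec (row A j) i‖) (Set.finite_range _).bddAbove j
  have hK := opNorm_two_le hq A (mul_nonneg hD hR) fun i =>
    (hDr i).trans (mul_le_mul_of_nonneg_left (hj i) hD)
  have hα0 : 0 ≤ lpnorm q (A.mulVec (row A j)) / (2 * linorm (A.mulVec (row A j))) :=
    div_nonneg (lpnorm_nonneg _ _) (by nlinarith [sq_nonneg (lpnorm 2 (row A j))])
  have hα : lpnorm q (A.mulVec (row A j)) / (2 * linorm (A.mulVec (row A j)))
      * lpnorm 2 (row A j) ≤ D := by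
    rcases hR.eq_or_lt with hR0 | hR0
    · rw [← hR0, mul_zero]
      exact hD
    · have hl : 0 < linorm (A.mulVec (row A j)) := (pow_pos hR0 2).trans_le hlin
      rw [div_mul_eq_mul_div, div_le_iff₀ (by linarith)]
      nlinarith [mul_le_mul_of_nonneg_right (hDr j) hR, mul_le_mul_of_nonneg_left hlin hD,
        mul_nonneg hD hl.le]
  have hβ0 : 0 ≤ lpnorm q (A.mulVec v) / lpnorm 2 (A.mulVec v) :=
    div_nonneg (lpnorm_nonneg _ _) (lpnorm_nonneg _ _)
  have hβ : lpnorm q (A.mulVec v) / lpnorm 2 (A.mulVec v) * opNorm 2 2 A ≤ D := by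
    have hvp := lpnorm_pos two_pos hv
    rcases hσ.eq_or_lt with h0 | h0
    · rw [← h0, mul_zero]
      exact hD
    · rw [hsv, div_mul_eq_mul_div, div_le_iff₀ (by positivity)]
      nlinarith [mul_le_mul_of_nonneg_right hDv hσ]
  set α := lpnorm q (A.mulVec (row A j)) / (2 * linorm (A.mulVec (row A j)))
  set β := lpnorm q (A.mulVec v) / lpnorm 2 (A.mulVec v)
  set R := lpnorm 2 (row A j)
  set σ := opNorm 2 2 A
  set b := (q - 2) / (2 * (q - 1)) with hb
  set a := 1 / (q - 1) with ha
  have ha0 : 0 ≤ a := by positivity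
  have hb0 : 0 ≤ b := div_nonneg (by linarith) (by linarith)
  calc α ^ b * β ^ a * opNorm 2 q A ≤ α ^ b * β ^ a * ((D * R) ^ b * σ ^ a) := by gcongr
    _ = (D * (α * R)) ^ b * (β * σ) ^ a := by
      rw [Real.mul_rpow hD hR, Real.mul_rpow hD (mul_nonneg hα0 hR), Real.mul_rpow hα0 hR,
        Real.mul_rpow hβ0 hσ]
      ring
    _ ≤ (D * D) ^ b * D ^ a := by gcongr
    _ = D := by
      have e : b + b + a = 1 := by rw [hb, ha]; field_simp; ring
      rw [Real.mul_rpow hD hD, ← Real.rpow_add_of_nonneg hD hb0 hb0,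
        ← Real.rpow_add_of_nonneg hD (by positivity) ha0, e, Real.rpow_one]

theorem stmt4 {m n : ℕ} (p q : ℝ) (hp1 : 1 ≤ p) (hp2 : p ≤ 2) (hq : 2 ≤ q)
    (A : Matrix (Fin m) (Fin n) ℂ) (hA : A ≠ 0)
    (j : Fin m) (hj : ∀ i, lpnorm 2 (row A i) ≤ lpnorm 2 (row A j))
    (v : Fin n → ℂ) (hv : v ≠ 0)
    (hsv : lpnorm 2 (A.mulVec v) = opNorm 2 2 A * lpnorm 2 v)
    (y : Fin n → ℂ) (hy0 : y ≠ 0)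
    (hy : lpnorm q (A.mulVec y) = opNorm 1 q A * lpnorm 1 y)
    (M : ℝ)
    (hM : M = sSup {t : ℝ | ∃ x ∈ insert y (insert v (Set.range (row A))), x ≠ 0 ∧
      t = lpnorm q (A.mulVec x) / lpnorm p x})
    (c : ℝ)
    (hc : c = sInf {t : ℝ | ∃ x ∈ insert v (Set.range (row A)), x ≠ 0 ∧
      t = lpnorm 2 x / lpnorm p x}) :
    M ≥ (lpnorm 1 y / lpnorm p y) ^ ((2 - p) / p) *
      ((lpnorm q (A.mulVec (row A j)) / (2 * linorm (A.mulVec (row A j)))) ^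
          ((q - 2) / (2 * (q - 1))) *
        (lpnorm q (A.mulVec v) / lpnorm 2 (A.mulVec v)) ^ (1 / (q - 1)) * c) ^
        (2 * (p - 1) / p) * opNorm p q A := by
  have hp0 : 0 < p := by linarith
  have hq0 : 0 < q := by linarith
  have hMle : ∀ x ∈ insert y (insert v (Set.range (row A))), x ≠ 0 →
      lpnorm q (A.mulVec x) / lpnorm p x ≤ M := by
    intro x hx hx0
    rw [hM]
    refine le_csSup ?_ ⟨x, hx, hx0, rfl⟩
    refine (bddAbove_opNorm hp1 (by linarith : 1 ≤ q) A).mono ?_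
    rintro _ ⟨z, -, hz0, rfl⟩
    exact ⟨⟨z, hz0⟩, rfl⟩
  have hM0 : 0 ≤ M := (div_nonneg (lpnorm_nonneg _ _) (lpnorm_nonneg _ _)).trans
    (hMle y (Set.mem_insert _ _) hy0)
  have hc0 : 0 < c := by
    have hfin : {t : ℝ | ∃ x ∈ insert v (Set.range (row A)), x ≠ 0 ∧
        t = lpnorm 2 x / lpnorm p x}.Finite := by
      refine (((Set.finite_range (row A)).insert v).image
        fun x => lpnorm 2 x / lpnorm p x).subset ?_
      rintro _ ⟨x, hx, -, rfl⟩
      exact ⟨x, hx, rfl⟩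
    have hne : {t : ℝ | ∃ x ∈ insert v (Set.range (row A)), x ≠ 0 ∧
        t = lpnorm 2 x / lpnorm p x}.Nonempty := ⟨_, v, Set.mem_insert _ _, hv, rfl⟩
    obtain ⟨x, -, hx0, hx⟩ := hne.csInf_mem hfin
    rw [hc, hx]
    exact div_pos (lpnorm_pos two_pos hx0) (lpnorm_pos hp0 hx0)
  have hcle : ∀ x ∈ insert v (Set.range (row A)), x ≠ 0 → c ≤ lpnorm 2 x / lpnorm p x := by
    intro x hx hx0
    rw [hc]
    refine csInf_le ⟨0, ?_⟩ ⟨x, hx, hx0, rfl⟩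
    rintro _ ⟨z, -, -, rfl⟩
    exact div_nonneg (lpnorm_nonneg _ _) (lpnorm_nonneg _ _)
  have hD : ∀ x ∈ insert v (Set.range (row A)),
      lpnorm q (A.mulVec x) ≤ M / c * lpnorm 2 x := by
    intro x hx
    by_cases hx0 : x = 0
    · rw [hx0, Matrix.mulVec_zero, lpnorm_zero hq0, lpnorm_zero two_pos, mul_zero]
    · have hxp := lpnorm_pos hp0 hx0
      have h1 := (div_le_iff₀ hxp).mp (hMle x (Set.mem_insert_of_mem _ hx) hx0)
      have h2 := (le_div_iff₀ hxp).mp (hcle x hx hx0)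
      rw [div_mul_eq_mul_div, le_div_iff₀ hc0]
      nlinarith [mul_le_mul_of_nonneg_left h2 hM0, mul_le_mul_of_nonneg_right h1 hc0.le]
  have hG := ratio_mul_opNorm_two_le hq A j hj v hv hsv (div_nonneg hM0 hc0.le)
    (hD v (Set.mem_insert _ _)) fun i => hD _ (Set.mem_insert_of_mem _ ⟨i, rfl⟩)
  rw [le_div_iff₀ hc0] at hG
  have hY : lpnorm 1 y / lpnorm p y * opNorm 1 q A ≤ M := by
    have h := hMle y (Set.mem_insert _ _) hy0
    rw [hy] at h
    refine le_of_eq_of_le ?_ h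
    ring
  have hG0 : 0 ≤ (lpnorm q (A.mulVec (row A j)) / (2 * linorm (A.mulVec (row A j)))) ^
          ((q - 2) / (2 * (q - 1))) *
        (lpnorm q (A.mulVec v) / lpnorm 2 (A.mulVec v)) ^ (1 / (q - 1)) := by
    have h0 : 0 ≤ linorm (A.mulVec (row A j)) := Real.iSup_nonneg fun _ => norm_nonneg _
    have h1 := lpnorm_nonneg q (A.mulVec (row A j))
    have h2 := lpnorm_nonneg q (A.mulVec v)
    have h3 := lpnorm_nonneg 2 (A.mulVec v)
    positivity
  have hY0 : 0 ≤ lpnorm 1 y / lpnorm p y := div_nonneg (lpnorm_nonneg _ _) (lpnorm_nonneg _ _)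
  have hK1 := opNorm_nonneg 1 q A
  have hK2 := opNorm_nonneg 2 q A
  have hK := opNorm_le hp0 A (q := q) (by positivity) <|
    lpnorm_mulVec_le_interp hp1 hp2 (by linarith : 1 ≤ q) A hK1 hK2
      (lpnorm_mulVec_le_opNorm le_rfl (by linarith) A)
      (lpnorm_mulVec_le_opNorm one_le_two (by linarith) A)
  set G := (lpnorm q (A.mulVec (row A j)) / (2 * linorm (A.mulVec (row A j)))) ^
          ((q - 2) / (2 * (q - 1))) *
        (lpnorm q (A.mulVec v) / lpnorm 2 (A.mulVec v)) ^ (1 / (q - 1))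
  set Y := lpnorm 1 y / lpnorm p y
  set s := (2 - p) / p with hs
  set t := 2 * (p - 1) / p with ht
  have hs0 : 0 ≤ s := div_nonneg (by linarith) hp0.le
  have ht0 : 0 ≤ t := div_nonneg (by linarith) hp0.le
  have hst : s + t = 1 := by rw [hs, ht]; field_simp; ring
  calc Y ^ s * (G * c) ^ t * opNorm p q A
      ≤ Y ^ s * (G * c) ^ t * (opNorm 1 q A ^ s * opNorm 2 q A ^ t) := by gcongr
    _ = (Y * opNorm 1 q A) ^ s * (G * opNorm 2 q A * c) ^ t := by
      rw [Real.mul_rpow hY0 hK1, mul_right_comm G, Real.mul_rpow (by positivity) hK2]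
      ring
    _ ≤ M ^ s * M ^ t := by gcongr
    _ = M := by rw [← Real.rpow_add_of_nonneg hM0 hs0 ht0, hst, Real.rpow_one]
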